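/- arXiv:2306.01751 — 3 statements merged into one kernel-verified Lean document; each statement's English description precedes it below -/
import Mathlib

section
/- Fix positive integers p, k, parameters β > 0, ε > 0, 0 < δ < 1/2, and let σ ≥ β·√( 1 + 2√(log(2p/δ)/k) + 2·log(2p/δ)/k ) · √(2(log(2/δ) + ε)) / ε. Define the randomized mechanism M(u) = (1/√k)·Wᵀu + G, where W is a p×k matrix with i.i.d. N(0,1) entries and G ∈ ℝ^k has i.i.d. N(0,σ²) entries independent of W. Then for any two β-adjacent vectors u, u′ ∈ [−1,1]^p and every Borel set O ⊆ ℝ^k, Pr(M(u) ∈ O) ≤ e^ε · Pr(M(u′) ∈ O) + δ, where the probabilities are over the joint randomness of W and G. -/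
open MeasureTheory ProbabilityTheory Real

/-- Two vectors `u, u' ∈ ℝᵖ` are `β`-adjacent if they differ in exactly one
coordinate `i` and `|u i − u' i| ≤ β`. -/
def Adjacent {p : ℕ} (β : ℝ) (u u' : Fin p → ℝ) : Prop :=
  ∃ i₀ : Fin p, u i₀ ≠ u' i₀ ∧ |u i₀ - u' i₀| ≤ β ∧ ∀ i : Fin p, i ≠ i₀ → u i = u' i


lemma lint_pi {k : ℕ} (μ : Fin k → Measure ℝ) [∀ i, IsProbabilityMeasure (μ i)]
    (f : Fin k → ℝ → ENNReal) (hf : ∀ i, Measurable (f i)) :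
    ∫⁻ x, ∏ j, f j (x j) ∂(Measure.pi μ) = ∏ j, ∫⁻ x, f j x ∂(μ j) := by
  have hi : iIndepFun (fun (j : Fin k) (x : Fin k → ℝ) => f j (x j)) (Measure.pi μ) :=
    iIndepFun_pi (X := f) (fun i => (hf i).aemeasurable)
  have h := lintegral_prod_eq_prod_lintegral_of_indepFun (μ := Measure.pi μ) Finset.univ
    (fun (j : Fin k) (x : Fin k → ℝ) => f j (x j)) hi (fun i => (hf i).comp (measurable_pi_apply i))
  rw [h]
  refine Finset.prod_congr rfl fun j _ => ?_
  exact (measurePreserving_eval μ j).lintegral_comp (hf j)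

lemma chern {k : ℕ} (μ : Fin k → Measure ℝ) [∀ i, IsProbabilityMeasure (μ i)]
    (f : Fin k → ℝ → ℝ) (hf : ∀ i, Measurable (f i)) (c : ℝ) :
    Measure.pi μ {x | c ≤ ∑ j, f j (x j)} ≤
      ENNReal.ofReal (exp (-c)) * ∏ j, ∫⁻ x, ENNReal.ofReal (exp (f j x)) ∂(μ j) := by
  rw [← lint_pi μ (fun j x => ENNReal.ofReal (exp (f j x))) (fun i => by have := hf i; fun_prop)]
  have h := mul_meas_ge_le_lintegral₀ (μ := Measure.pi μ)
    (f := fun x => ∏ j, ENNReal.ofReal (exp (f j (x j)))) (by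
      apply Measurable.aemeasurable
      refine Finset.measurable_prod _ fun j _ => ?_
      have := hf j; fun_prop) (ENNReal.ofReal (exp c))
  have e : {x : Fin k → ℝ | c ≤ ∑ j, f j (x j)} =
      {x | ENNReal.ofReal (exp c) ≤ ∏ j, ENNReal.ofReal (exp (f j (x j)))} := by
    ext x
    simp only [Set.mem_ofPred_eq]
    rw [← ENNReal.ofReal_prod_of_nonneg (fun _ _ => (exp_pos _).le), ← Real.exp_sum,
      ENNReal.ofReal_le_ofReal_iff (exp_pos _).le, exp_le_exp]
  rw [e]
  set S := {x : Fin k → ℝ | ENNReal.ofReal (exp c) ≤ ∏ j, ENNReal.ofReal (exp (f j (x j)))}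
  calc Measure.pi μ S = ENNReal.ofReal (exp (-c)) * (ENNReal.ofReal (exp c) * Measure.pi μ S) := by
        rw [← mul_assoc, ← ENNReal.ofReal_mul (exp_pos _).le, ← Real.exp_add]; simp
    _ ≤ _ := by gcongr

lemma pi_dens {k : ℕ} (μ : Fin k → Measure ℝ) [∀ i, IsProbabilityMeasure (μ i)]
    (f : Fin k → ℝ → ENNReal) (hf : ∀ i, Measurable (f i))
    [∀ i, IsProbabilityMeasure ((μ i).withDensity (f i))] :
    Measure.pi (fun i => (μ i).withDensity (f i)) =
      (Measure.pi μ).withDensity (fun x => ∏ j, f j (x j)) := by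
  refine (Measure.pi_eq (μ := fun i => (μ i).withDensity (f i)) ?_)
  intro s hs
  rw [withDensity_apply _ (MeasurableSet.univ_pi hs), ← lintegral_indicator (MeasurableSet.univ_pi hs)]
  have : ∀ x : Fin k → ℝ, (Set.univ.pi s).indicator (fun x => ∏ j, f j (x j)) x
      = ∏ j, (s j).indicator (f j) (x j) := by
    intro x
    by_cases h : x ∈ Set.univ.pi s
    · rw [Set.indicator_of_mem h]
      exact Finset.prod_congr rfl fun j _ => (Set.indicator_of_mem (h j trivial) _).symm
    · rw [Set.indicator_of_notMem h]
      simp only [Set.mem_univ_pi, not_forall] at h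
      obtain ⟨j, hj⟩ := h
      exact (Finset.prod_eq_zero (Finset.mem_univ j) (Set.indicator_of_notMem hj _)).symm
  simp_rw [this]
  rw [lint_pi μ (fun j => (s j).indicator (f j)) (fun j => (hf j).indicator (hs j))]
  refine Finset.prod_congr rfl fun j _ => ?_
  rw [withDensity_apply _ (hs j), lintegral_indicator (hs j)]

lemma gauss_dens (a : ℝ) (s : NNReal) (hs : s ≠ 0) :
    gaussianReal a s = (gaussianReal 0 s).withDensity
      (fun x => ENNReal.ofReal (exp ((2 * a * x - a ^ 2) / (2 * s)))) := by
  rw [gaussianReal_of_var_ne_zero _ hs, gaussianReal_of_var_ne_zero _ hs,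
    ← withDensity_mul _ (measurable_gaussianPDF _ _) (by fun_prop)]
  congr 1
  ext x
  simp only [gaussianPDF, Pi.mul_apply, gaussianPDFReal]
  rw [← ENNReal.ofReal_mul (by positivity), mul_assoc (√(2 * π * s))⁻¹, ← Real.exp_add]
  congr 3
  have : (s : ℝ) ≠ 0 := by exact_mod_cast hs
  field_simp
  ring_nf

lemma gauss_mgf (s : NNReal) (t : ℝ) :
    ∫⁻ x, ENNReal.ofReal (exp (t * x)) ∂(gaussianReal 0 s) = ENNReal.ofReal (exp (s * t ^ 2 / 2)) := by
  rw [← ofReal_integral_eq_lintegral_ofReal (integrable_exp_mul_gaussianReal t)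
    (Filter.Eventually.of_forall fun x => (exp_pos _).le)]
  have := congrFun (mgf_id_gaussianReal (μ := 0) (v := s)) t
  simp only [mgf, id, zero_mul, zero_add] at this
  rw [this]

lemma gauss_sq (l : ℝ) (hl : l < 1 / 2) :
    ∫⁻ x, ENNReal.ofReal (exp (l * x ^ 2)) ∂(gaussianReal 0 1) = ENNReal.ofReal (√(1 - 2 * l)⁻¹) := by
  rw [gaussianReal_of_var_ne_zero _ one_ne_zero,
    lintegral_withDensity_eq_lintegral_mul _ (measurable_gaussianPDF _ _) (by fun_prop)]
  have hb : 0 < 1 / 2 - l := by linarith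
  have : ∀ x : ℝ, (gaussianPDF 0 1 * fun x => ENNReal.ofReal (exp (l * x ^ 2))) x =
      ENNReal.ofReal ((√(2 * π))⁻¹ * exp (-(1 / 2 - l) * x ^ 2)) := by
    intro x
    simp only [gaussianPDF, Pi.mul_apply, gaussianPDFReal]
    rw [← ENNReal.ofReal_mul (by positivity), mul_assoc, ← Real.exp_add]
    simp only [NNReal.coe_one, mul_one, sub_zero]
    congr 3
    ring
  simp_rw [this]
  rw [← ofReal_integral_eq_lintegral_ofReal ((integrable_exp_neg_mul_sq hb).const_mul _)
    (Filter.Eventually.of_forall fun x => by positivity), integral_const_mul, integral_gaussian,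
    ← Real.sqrt_inv, ← Real.sqrt_mul (by positivity)]
  congr 2
  have : 1 - 2 * l ≠ 0 := by linarith
  have := pi_pos.ne'
  field_simp

lemma chi_tail (k : ℕ) (hk : 0 < k) (t : ℝ) (ht : 0 ≤ t) :
    Measure.pi (fun _ : Fin k => gaussianReal 0 1)
      {x | (k : ℝ) * (1 + 2 * √(t / k) + 2 * t / k) ≤ ∑ j, x j ^ 2} ≤ ENNReal.ofReal (exp (-t)) := by
  have hk' : (0 : ℝ) < k := by exact_mod_cast hk
  set s := √(t / k) with hs
  have hs0 : 0 ≤ s := Real.sqrt_nonneg _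
  have hst : t = k * s ^ 2 := by
    rw [hs, Real.sq_sqrt (by positivity)]; field_simp
  set l := s / (1 + 2 * s) with hl
  have hl0 : 0 ≤ l := by positivity
  have hl2 : 1 - 2 * l = (1 + 2 * s)⁻¹ := by rw [hl]; field_simp; ring
  have hl1 : l < 1 / 2 := by
    have : 0 < (1 + 2 * s)⁻¹ := by positivity
    linarith
  have h := chern (fun _ : Fin k => gaussianReal 0 1) (fun _ x => l * x ^ 2) (fun _ => by fun_prop)
    (l * ((k : ℝ) * (1 + 2 * s + 2 * t / k)))
  refine (measure_mono ?_).trans (h.trans ?_)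
  · intro x hx
    simp only [Set.mem_ofPred_eq] at hx ⊢
    rw [← Finset.mul_sum]
    gcongr
  · simp only [gauss_sq l hl1, Finset.prod_const, Finset.card_univ, Fintype.card_fin]
    rw [← ENNReal.ofReal_pow (by positivity), ← ENNReal.ofReal_mul (by positivity), hl2, inv_inv]
    apply ENNReal.ofReal_le_ofReal
    have hy : log (1 + 2 * s) ≤ 2 * s * (1 + s) / (1 + 2 * s) := by
      have h1 : 0 ≤ log (1 + 2 * s) := Real.log_nonneg (by linarith)
      have h2 := Real.self_le_sinh_iff.2 h1
      rw [Real.sinh_eq, Real.exp_neg, Real.exp_log (by positivity)] at h2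
      convert h2 using 1
      field_simp; ring
    have h3 : √(1 + 2 * s) ≤ exp (s * (1 + s) / (1 + 2 * s)) := by
      rw [Real.sqrt_le_left (exp_pos _).le, ← Real.exp_nat_mul,
        ← Real.log_le_iff_le_exp (by positivity)]
      convert hy using 1
      push_cast; ring
    calc _ ≤ exp (-(l * (k * (1 + 2 * s + 2 * t / k)))) * exp (s * (1 + s) / (1 + 2 * s)) ^ k := by
          gcongr
      _ = exp (-t) := by
        rw [← Real.exp_nat_mul, ← Real.exp_add, hst, hl]
        congr 1
        field_simp
        ring

lemma gauss_dp (k : ℕ) (s : NNReal) (hs : s ≠ 0) (v : Fin k → ℝ) (ε L : ℝ) (hε : 0 < ε) (hL : 0 < L)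
    (hv : (∑ j, v j ^ 2) * (2 * (L + ε)) ≤ s * ε ^ 2)
    (A : Set (Fin k → ℝ)) (hA : MeasurableSet A) :
    Measure.pi (fun _ : Fin k => gaussianReal 0 s) {x | (fun j => x j + v j) ∈ A} ≤
      ENNReal.ofReal (exp ε) * Measure.pi (fun _ : Fin k => gaussianReal 0 s) A
       + ENNReal.ofReal (exp (-L)) := by
  set μ := Measure.pi (fun _ : Fin k => gaussianReal 0 s) with hμ
  set N := ∑ j, v j ^ 2 with hN
  have hs' : (0 : ℝ) < s := by exact_mod_cast pos_iff_ne_zero.2 hs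
  have hN0 : 0 ≤ N := Finset.sum_nonneg fun _ _ => sq_nonneg _
  have hmT : Measurable (fun (x : Fin k → ℝ) j => x j + v j) := by fun_prop
  let f : Fin k → ℝ → ENNReal := fun j x => ENNReal.ofReal (exp ((2 * v j * x - v j ^ 2) / (2 * s)))
  have hshift : μ.map (fun x j => x j + v j) = μ.withDensity (fun x => ∏ j, f j (x j)) := by
    have hd : ∀ j, (gaussianReal 0 s).withDensity (f j) = gaussianReal (v j) s :=
      fun j => (gauss_dens (v j) s hs).symm
    have : ∀ j, IsProbabilityMeasure ((gaussianReal 0 s).withDensity (f j)) := by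
      intro j; rw [hd]; infer_instance
    rw [hμ, ← pi_dens (fun _ => gaussianReal 0 s) f (fun j => by simp only [f]; fun_prop)]
    simp_rw [hd]
    rw [Measure.pi_map_pi (f := fun j x => x + v j) (fun j => by fun_prop)]
    simp [gaussianReal_map_add_const]
  have hF : ∀ x : Fin k → ℝ, ∏ j, f j (x j) =
      ENNReal.ofReal (exp ((2 * (∑ j, v j * x j) - N) / (2 * s))) := by
    intro x
    simp only [f]
    rw [← ENNReal.ofReal_prod_of_nonneg (fun _ _ => (exp_pos _).le), ← Real.exp_sum, ← Finset.sum_div,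
      Finset.sum_sub_distrib, Finset.mul_sum]
    simp only [mul_assoc, hN]
  set B : Set (Fin k → ℝ) := {x | s * ε + N / 2 ≤ ∑ j, v j * x j} with hB
  have hBm : MeasurableSet B := measurableSet_le (by fun_prop) (by fun_prop)
  have h1 : μ {x | (fun j => x j + v j) ∈ A} = μ.map (fun x j => x j + v j) A :=
    (Measure.map_apply hmT hA).symm
  have h2 : μ.map (fun x j => x j + v j) (A \ B) ≤ ENNReal.ofReal (exp ε) * μ A := by
    rw [hshift, withDensity_apply _ (hA.diff hBm)]
    calc _ ≤ ∫⁻ x in A \ B, ENNReal.ofReal (exp ε) ∂μ := by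
          refine setLIntegral_mono measurable_const fun x hx => ?_
          rw [hF]
          apply ENNReal.ofReal_le_ofReal
          rw [exp_le_exp, div_le_iff₀ (by positivity)]
          have := hx.2
          simp only [hB, Set.mem_ofPred_eq, not_le] at this
          linarith
      _ = ENNReal.ofReal (exp ε) * μ (A \ B) := by rw [setLIntegral_const]
      _ ≤ _ := by gcongr; exact Set.sdiff_subset
  have h3 : μ.map (fun x j => x j + v j) B ≤ ENNReal.ofReal (exp (-L)) := by
    rw [Measure.map_apply hmT hBm]
    rcases hN0.eq_or_lt with h0 | h0
    · have hv0 : ∀ j, v j = 0 := by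
        intro j
        have := (Finset.sum_eq_zero_iff_of_nonneg (fun j _ => sq_nonneg (v j))).1 (hN ▸ h0.symm) j
          (Finset.mem_univ j)
        exact pow_eq_zero_iff two_ne_zero |>.1 this
      have : (fun (x : Fin k → ℝ) j => x j + v j) ⁻¹' B = ∅ := by
        ext x
        simp only [hB, Set.mem_preimage, Set.mem_ofPred_eq, hv0, zero_mul, Finset.sum_const_zero,
          ← h0, Set.mem_empty_iff_false, iff_false, not_le]
        positivity
      rw [this]; simp
    · set c := s * ε - N / 2 with hc
      have hNs : N * 2 ≤ s * ε := by
        have : N * 2 * ε ≤ s * ε * ε := by nlinarith [mul_pos h0 hL]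
        exact le_of_mul_le_mul_right this hε
      have hc0 : 0 < c := by nlinarith [mul_pos hs' hε]
      set t := c / (s * N) with ht
      have ht0 : 0 < t := by positivity
      have h := chern (fun _ : Fin k => gaussianReal 0 s) (fun j x => (t * v j) * x)
        (fun _ => by fun_prop) (t * c)
      refine (measure_mono ?_).trans (h.trans ?_)
      · intro x hx
        simp only [hB, Set.mem_preimage, Set.mem_ofPred_eq, mul_add, Finset.sum_add_distrib] at hx ⊢
        simp only [mul_assoc]
        rw [← Finset.mul_sum]
        gcongr
        simp only [← pow_two] at hx
        linarith
      · simp only [gauss_mgf]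
        rw [← ENNReal.ofReal_prod_of_nonneg (fun _ _ => (exp_pos _).le), ← Real.exp_sum,
          ← ENNReal.ofReal_mul (exp_pos _).le, ← Real.exp_add]
        apply ENNReal.ofReal_le_ofReal
        rw [exp_le_exp]
        have e1 : ∑ j, (s : ℝ) * (t * v j) ^ 2 / 2 = s * t ^ 2 * N / 2 := by
          rw [hN, Finset.mul_sum, Finset.sum_div]
          exact Finset.sum_congr rfl fun j _ => by ring
        rw [e1]
        have e2 : -(t * c) + s * t ^ 2 * N / 2 = -(c ^ 2 / (2 * s * N)) := by
          rw [ht]; field_simp; ring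
        rw [e2, neg_le_neg_iff, le_div_iff₀ (by positivity), hc]
        nlinarith [sq_nonneg N]
  rw [h1]
  calc _ ≤ μ.map (fun x j => x j + v j) ((A \ B) ∪ B) := by
        apply measure_mono; intro x hx; by_cases h : x ∈ B <;> simp [h, hx]
    _ ≤ _ := measure_union_le _ _
    _ ≤ _ := add_le_add h2 h3

/-- **Analytic DP-RP-G.** With `σ ≥ β·√(1 + 2√(log(2p/δ)/k) + 2·log(2p/δ)/k)·√(2(log(2/δ)+ε))/ε`,
the mechanism `M(u) = (1/√k)·Wᵀu + G` (with `W` i.i.d. `N(0,1)` and `G` i.i.d. `N(0,σ²)`,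
independent) satisfies `(ε,δ)`-differential privacy: for any `β`-adjacent
`u, u' ∈ [−1,1]ᵖ` and every Borel set `O ⊆ ℝᵏ`,
`Pr(M(u) ∈ O) ≤ e^ε · Pr(M(u') ∈ O) + δ`. -/
theorem analytic_dp_rp_g (p k : ℕ) (hp : 0 < p) (hk : 0 < k)
    (β ε δ σ : ℝ) (hβ : 0 < β) (hε : 0 < ε) (hδ0 : 0 < δ) (hδ1 : δ < 1 / 2)
    (hσ : σ ≥ β * Real.sqrt (1 + 2 * Real.sqrt (Real.log (2 * p / δ) / k)
              + 2 * Real.log (2 * p / δ) / k)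
            * Real.sqrt (2 * (Real.log (2 / δ) + ε)) / ε)
    (u u' : Fin p → ℝ)
    (hu : ∀ i, u i ∈ Set.Icc (-1 : ℝ) 1) (hu' : ∀ i, u' i ∈ Set.Icc (-1 : ℝ) 1)
    (hadj : Adjacent β u u')
    (O : Set (Fin k → ℝ)) (hO : MeasurableSet O) :
    (Measure.prod
        (Measure.pi (fun _ : Fin p => Measure.pi (fun _ : Fin k => gaussianReal 0 1)))
        (Measure.pi (fun _ : Fin k => gaussianReal 0 ⟨σ ^ 2, sq_nonneg σ⟩)))
      {ω : (Fin p → Fin k → ℝ) × (Fin k → ℝ) |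
        (fun j => (1 / Real.sqrt k) * ∑ i : Fin p, ω.1 i j * u i + ω.2 j) ∈ O}
      ≤ ENNReal.ofReal (Real.exp ε)
          * (Measure.prod
              (Measure.pi (fun _ : Fin p => Measure.pi (fun _ : Fin k => gaussianReal 0 1)))
              (Measure.pi (fun _ : Fin k => gaussianReal 0 ⟨σ ^ 2, sq_nonneg σ⟩)))
            {ω : (Fin p → Fin k → ℝ) × (Fin k → ℝ) |
              (fun j => (1 / Real.sqrt k) * ∑ i : Fin p, ω.1 i j * u' i + ω.2 j) ∈ O}
        + ENNReal.ofReal δ := by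
  obtain ⟨i₀, -, hΔ, hrest⟩ := hadj
  set μW := Measure.pi (fun _ : Fin p => Measure.pi (fun _ : Fin k => gaussianReal 0 1)) with hμW
  set s : NNReal := ⟨σ ^ 2, sq_nonneg σ⟩ with hs
  have hsv : (s : ℝ) = σ ^ 2 := rfl
  set μG := Measure.pi (fun _ : Fin k => gaussianReal 0 s) with hμG
  have hk' : (0 : ℝ) < k := by exact_mod_cast hk
  have hp' : (1 : ℝ) ≤ p := by exact_mod_cast hp
  set t := Real.log (2 * p / δ) with ht
  set L := Real.log (2 / δ) with hL
  have hL0 : 0 < L := Real.log_pos (by rw [lt_div_iff₀ hδ0]; linarith)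
  have ht0 : 0 ≤ t := Real.log_nonneg (by rw [le_div_iff₀ hδ0]; linarith)
  have hexpL : Real.exp (-L) = δ / 2 := by
    rw [hL, Real.exp_neg, Real.exp_log (by positivity), inv_div]
  have hexpt : Real.exp (-t) ≤ δ / 2 := by
    rw [ht, Real.exp_neg, Real.exp_log (by positivity), inv_div]
    gcongr
    linarith
  set R := 1 + 2 * Real.sqrt (t / k) + 2 * t / k with hR
  have hR0 : 0 < R := by positivity
  have hσ0 : 0 < σ := lt_of_lt_of_le (by positivity) hσ
  have hs0 : s ≠ 0 := by
    intro h
    have : (s : ℝ) = 0 := by rw [h]; rfl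
    rw [hsv] at this
    exact absurd this (by positivity)
  have hσ2 : β ^ 2 * R * (2 * (L + ε)) ≤ σ ^ 2 * ε ^ 2 := by
    have h1 : β * Real.sqrt R * Real.sqrt (2 * (L + ε)) ≤ σ * ε := by
      rw [ge_iff_le, div_le_iff₀ hε] at hσ; exact hσ
    have h2 := pow_le_pow_left₀ (by positivity) h1 2
    rw [mul_pow, mul_pow, mul_pow, Real.sq_sqrt hR0.le, Real.sq_sqrt (by positivity)] at h2
    exact h2
  have hmeas : ∀ w : Fin p → ℝ, MeasurableSet {ω : (Fin p → Fin k → ℝ) × (Fin k → ℝ) |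
        (fun j => (1 / Real.sqrt k) * ∑ i : Fin p, ω.1 i j * w i + ω.2 j) ∈ O} := by
    intro w
    have : Measurable (fun ω : (Fin p → Fin k → ℝ) × (Fin k → ℝ) =>
        (fun j => (1 / Real.sqrt k) * ∑ i : Fin p, ω.1 i j * w i + ω.2 j)) := by fun_prop
    exact this hO
  rw [Measure.prod_apply (hmeas u), Measure.prod_apply (hmeas u')]
  set Bad : Set (Fin p → Fin k → ℝ) := {W | k * R ≤ ∑ j, W i₀ j ^ 2} with hBad
  have hBadm : MeasurableSet Bad := measurableSet_le (by fun_prop) (by fun_prop)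
  have hBadP : μW Bad ≤ ENNReal.ofReal (δ / 2) := by
    have h := chi_tail k hk t ht0
    have hm : MeasurableSet {x : Fin k → ℝ | k * R ≤ ∑ j, x j ^ 2} :=
      measurableSet_le (by fun_prop) (by fun_prop)
    have e := (measurePreserving_eval
      (fun _ : Fin p => Measure.pi (fun _ : Fin k => gaussianReal 0 1)) i₀).measure_preimage
      hm.nullMeasurableSet
    calc μW Bad = _ := e
      _ ≤ _ := h
      _ ≤ _ := ENNReal.ofReal_le_ofReal hexpt
  have key : ∀ W : Fin p → Fin k → ℝ,
      μG {g | (fun j => (1 / Real.sqrt k) * ∑ i : Fin p, W i j * u i + g j) ∈ O} ≤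
      ENNReal.ofReal (Real.exp ε) *
        μG {g | (fun j => (1 / Real.sqrt k) * ∑ i : Fin p, W i j * u' i + g j) ∈ O}
      + (ENNReal.ofReal (δ / 2) + Bad.indicator 1 W) := by
    intro W
    by_cases hW : W ∈ Bad
    · rw [Set.indicator_of_mem hW]
      calc _ ≤ (1 : ENNReal) := prob_le_one
        _ ≤ ENNReal.ofReal (δ / 2) + 1 := le_add_self
        _ ≤ _ := le_add_self
    · rw [Set.indicator_of_notMem hW, add_zero]
      simp only [hBad, Set.mem_ofPred_eq, not_le] at hW
      have hsum : (∑ j, ((1 / Real.sqrt k) * (W i₀ j * (u i₀ - u' i₀))) ^ 2) ≤ β ^ 2 * R := by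
        have e : (∑ j, ((1 / Real.sqrt k) * (W i₀ j * (u i₀ - u' i₀))) ^ 2)
            = (u i₀ - u' i₀) ^ 2 * ((∑ j, W i₀ j ^ 2) / k) := by
          rw [Finset.sum_div, Finset.mul_sum]
          refine Finset.sum_congr rfl fun j _ => ?_
          rw [mul_pow, div_pow, Real.sq_sqrt hk'.le]
          ring
        rw [e]
        have h1 : (u i₀ - u' i₀) ^ 2 ≤ β ^ 2 := by
          rw [← sq_abs]; gcongr
        have h2 : (∑ j, W i₀ j ^ 2) / k ≤ R := by
          rw [div_le_iff₀ hk']; linarith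
        gcongr
      have hA : MeasurableSet {g : Fin k → ℝ |
          (fun j => (1 / Real.sqrt k) * ∑ i : Fin p, W i j * u' i + g j) ∈ O} := by
        have : Measurable (fun g : Fin k → ℝ =>
          (fun j => (1 / Real.sqrt k) * ∑ i : Fin p, W i j * u' i + g j)) := by fun_prop
        exact this hO
      have h := gauss_dp k s hs0 (fun j => (1 / Real.sqrt k) * (W i₀ j * (u i₀ - u' i₀))) ε L hε hL0
        (by
          rw [hsv]
          refine le_trans ?_ hσ2
          gcongr) _ hA
      rw [hexpL] at h
      refine le_trans (le_of_eq ?_) h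
      congr 1
      ext g
      simp only [Set.mem_ofPred_eq]
      have : ∀ j, ∑ i, W i j * u i = ∑ i, W i j * u' i + W i₀ j * (u i₀ - u' i₀) := by
        intro j
        rw [← sub_eq_iff_eq_add', ← Finset.sum_sub_distrib, Finset.sum_eq_single i₀]
        · ring
        · intro i _ hi
          rw [hrest i hi]; ring
        · simp
      simp only [this]
      constructor <;> intro h <;> convert h using 2 <;> ring
  have hm' : Measurable (fun W : Fin p → Fin k → ℝ =>
      μG {g | (fun j => (1 / Real.sqrt k) * ∑ i : Fin p, W i j * u' i + g j) ∈ O}) :=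
    measurable_measure_prodMk_left (hmeas u')
  calc _ ≤ ∫⁻ W, (ENNReal.ofReal (Real.exp ε) *
        μG {g | (fun j => (1 / Real.sqrt k) * ∑ i : Fin p, W i j * u' i + g j) ∈ O}
      + (ENNReal.ofReal (δ / 2) + Bad.indicator 1 W)) ∂μW := lintegral_mono key
    _ = ENNReal.ofReal (Real.exp ε) * (∫⁻ W,
        μG {g | (fun j => (1 / Real.sqrt k) * ∑ i : Fin p, W i j * u' i + g j) ∈ O} ∂μW)
        + (ENNReal.ofReal (δ / 2) + μW Bad) := by
      rw [lintegral_add_left (hm'.const_mul _), lintegral_const_mul _ hm',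
        lintegral_add_left measurable_const, lintegral_indicator_one hBadm]
      simp
    _ ≤ ENNReal.ofReal (Real.exp ε) * (∫⁻ W,
        μG {g | (fun j => (1 / Real.sqrt k) * ∑ i : Fin p, W i j * u' i + g j) ∈ O} ∂μW)
        + (ENNReal.ofReal (δ / 2) + ENNReal.ofReal (δ / 2)) := by gcongr
    _ = _ := by
      rw [← ENNReal.ofReal_add (by positivity) (by positivity), add_halves]
      rfl
end

section
/- Let u, v ∈ ℝ^p, let W be a p×k random matrix with i.i.d. Rademacher entries (each entry equals +1 or −1 with probability 1/2), and set x = (1/√k)Wᵀu and y = (1/√k)Wᵀv. Let a, b ∈ ℝ^k have i.i.d. N(0,σ²) entries, with a, b and W mutually independent, and define ĝ = Σ_{j=1}^k (x_j + a_j)(y_j + b_j). Then E[ĝ] = Σ_{i=1}^p u_i v_i, and Var(ĝ) = σ²·Σ_{i=1}^p (u_i² + v_i²) + k·σ⁴ + (1/k)·( (Σ_{i=1}^p u_i²)(Σ_{i=1}^p v_i²) + (Σ_{i=1}^p u_i v_i)² − 2·Σ_{i=1}^p u_i² v_i² ). -/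
open MeasureTheory ProbabilityTheory Real
open scoped ENNReal

/-- The Rademacher distribution on `ℝ`: `+1` or `−1`, each with probability `1/2`. -/
noncomputable def rademacher : Measure ℝ :=
  (2 : ℝ≥0∞)⁻¹ • (Measure.dirac 1 + Measure.dirac (-1))

instance : IsProbabilityMeasure rademacher := by
  constructor
  simp [rademacher, Measure.add_apply]
  rw [ENNReal.inv_two_add_inv_two]


lemma aux_holder : ENNReal.HolderTriple 4 4 2 where
  inv_add_inv_eq_inv := by
    rw [← two_mul, show (4:ℝ≥0∞) = 2 * 2 by norm_num, ENNReal.mul_inv (by simp) (by simp),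
      ← mul_assoc, ENNReal.mul_inv_cancel (by simp) (by simp), one_mul]

lemma aux_memLp_sum {Ω : Type*} [MeasurableSpace Ω] {μ : Measure Ω} {k : ℕ}
    {X Y : Fin k → Ω → ℝ} (hX : ∀ j, MemLp (X j) 4 μ) (hY : ∀ j, MemLp (Y j) 4 μ) :
    MemLp (fun z => ∑ j, X j z * Y j z) 2 μ := by
  have := aux_holder
  exact memLp_finsetSum _ (fun j _ => (hY j).mul' (hX j))

lemma aux_int_sum {k : ℕ} (μ : Measure ℝ) [IsProbabilityMeasure μ] (h2 : MemLp id 2 μ)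
    (h0 : ∫ x, x ∂μ = 0) (d : ℝ) (c : Fin k → ℝ) :
    ∫ b : Fin k → ℝ, (d + ∑ j, c j * b j) ∂(Measure.pi fun _ => μ) = d := by
  have hi : ∀ j : Fin k, Integrable (fun b : Fin k → ℝ => b j) (Measure.pi fun _ => μ) := fun j =>
    ((h2.comp_measurePreserving (measurePreserving_eval (fun _ : Fin k => μ) j)).integrable
      (by norm_num))
  rw [integral_add (integrable_const _) (integrable_finsetSum _ fun j _ => (hi j).const_mul _),
    integral_finsetSum _ fun j _ => (hi j).const_mul _]
  have : ∀ j : Fin k, ∫ b : Fin k → ℝ, b j ∂(Measure.pi fun _ => μ) = 0 := fun j => by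
    rw [← h0]
    exact integral_comp_eval (μ := fun _ : Fin k => μ) (i := j) (f := fun x : ℝ => x)
      (by fun_prop)
  simp [integral_const_mul, this]

lemma aux_int_sq {k : ℕ} (μ : Measure ℝ) [IsProbabilityMeasure μ] (h2 : MemLp id 2 μ)
    (h0 : ∫ x, x ∂μ = 0) (s : ℝ) (hs : Var[id; μ] = s) (d : ℝ) (c : Fin k → ℝ) :
    ∫ b : Fin k → ℝ, (d + ∑ j, c j * b j) ^ 2 ∂(Measure.pi fun _ => μ)
      = d ^ 2 + s * ∑ j, c j ^ 2 := by
  have hm : MemLp (fun b : Fin k → ℝ => ∑ j, c j * b j) 2 (Measure.pi fun _ => μ) :=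
    memLp_finsetSum _ fun j _ =>
    ((h2.comp_measurePreserving (measurePreserving_eval (fun _ : Fin k => μ) j)).const_mul _)
  have hm' : MemLp (fun b : Fin k → ℝ => d + ∑ j, c j * b j) 2 (Measure.pi fun _ => μ) :=
    (memLp_const d).add hm
  have h1 := variance_eq_sub hm'
  have h3 : Var[fun b : Fin k → ℝ => d + ∑ j, c j * b j; Measure.pi fun _ => μ]
      = s * ∑ j, c j ^ 2 := by
    rw [variance_const_add hm.1]
    have := variance_sum_pi (μ := fun _ : Fin k => μ) (X := fun j x => c j * id x)
      (fun j => h2.const_mul _)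
    rw [show (fun b : Fin k → ℝ => ∑ j, c j * b j) = ∑ j, fun b : Fin k → ℝ => c j * id (b j) by
      ext b; simp, this]
    simp_rw [variance_const_mul, hs]
    rw [Finset.mul_sum]
    exact Finset.sum_congr rfl fun j _ => mul_comm _ _
  rw [h3, aux_int_sum μ h2 h0] at h1
  simp only [Pi.pow_apply] at h1
  linarith

lemma aux_int_coord {k : ℕ} (μ : Measure ℝ) [IsProbabilityMeasure μ] (h2 : MemLp id 2 μ)
    (h0 : ∫ x, x ∂μ = 0) (s : ℝ) (hs : Var[id; μ] = s) (d : ℝ) (j : Fin k) :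
    ∫ b : Fin k → ℝ, (d + b j) ^ 2 ∂(Measure.pi fun _ => μ) = d ^ 2 + s := by
  have := aux_int_sq μ h2 h0 s hs d (Pi.single j 1 : Fin k → ℝ)
  simpa [Pi.single_apply] using this

lemma aux_int4 {Ω : Type*} [MeasurableSpace Ω] {μ : Measure Ω} [IsProbabilityMeasure μ]
    {A B C D : Ω → ℝ} (hA : Integrable A μ) (hB : Integrable B μ) (hC : Integrable C μ)
    (hD : Integrable D μ) (e : ℝ) :
    ∫ x, (A x + B x + C x + D x + e) ∂μ
      = ∫ x, A x ∂μ + ∫ x, B x ∂μ + ∫ x, C x ∂μ + ∫ x, D x ∂μ + e := by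
  have h1 : Integrable (fun x => A x + B x) μ := hA.add hB
  have h2 : Integrable (fun x => A x + B x + C x) μ := h1.add hC
  have h3 : Integrable (fun x => A x + B x + C x + D x) μ := h2.add hD
  rw [integral_add h3 (integrable_const _), integral_add h2 hD, integral_add h1 hC,
    integral_add hA hB]
  simp


lemma rad_ae : ∀ᵐ x ∂rademacher, x ^ 2 = 1 := by
  unfold rademacher
  refine Measure.ae_smul_measure ?_ _
  rw [ae_add_measure_iff]
  constructor <;> rw [ae_dirac_iff (measurableSet_eq_fun (by fun_prop) (by fun_prop))] <;> norm_num

lemma rad_memLp (q : ℝ≥0∞) : MemLp id q rademacher :=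
  MemLp.of_bound (by fun_prop) 1 (by
    filter_upwards [rad_ae] with x hx
    rw [id, Real.norm_eq_abs, ← sq_le_one_iff_abs_le_one, hx])

lemma rad_int : ∫ x, x ∂rademacher = 0 := by
  unfold rademacher
  rw [integral_smul_measure, integral_add_measure (integrable_dirac (by simp))
    (integrable_dirac (by simp))]
  simp

lemma rad_var : Var[id; rademacher] = 1 := by
  rw [variance_eq_sub (rad_memLp 2)]
  have : ∫ x, (id ^ 2 : ℝ → ℝ) x ∂rademacher = 1 := by
    rw [integral_congr_ae (g := fun _ => 1)]
    · simp
    · filter_upwards [rad_ae] with x hx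
      simpa using hx
  rw [this]; simp [rad_int]

/-- column projections -/
noncomputable def colDot {p k : ℕ} (W : Fin p → Fin k → ℝ) (u : Fin p → ℝ) (j : Fin k) : ℝ :=
  ∑ i, W i j * u i

noncomputable def radPi (p k : ℕ) : Measure (Fin p → Fin k → ℝ) :=
  Measure.pi (fun _ : Fin p => Measure.pi (fun _ : Fin k => rademacher))

instance (p k : ℕ) : IsProbabilityMeasure (radPi p k) := by unfold radPi; infer_instance

lemma colDot_memLp {p k : ℕ} (u : Fin p → ℝ) (j : Fin k) :
    MemLp (fun W => colDot W u j) 4 (radPi p k) := by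
  unfold colDot
  refine memLp_finsetSum _ fun i _ => MemLp.mul_const ?_ _
  exact ((rad_memLp 4).comp_measurePreserving
    (measurePreserving_eval (fun _ : Fin k => rademacher) j)).comp_measurePreserving
    (measurePreserving_eval (fun _ : Fin p => Measure.pi (fun _ : Fin k => rademacher)) i)

lemma radPi_succ {p k : ℕ} (f : (Fin (p+1) → Fin k → ℝ) → ℝ) (hf : Integrable f (radPi (p+1) k)) :
    ∫ W, f W ∂(radPi (p+1) k)
      = ∫ W, ∫ r, f (Fin.cons r W : Fin (p+1) → Fin k → ℝ)
        ∂(Measure.pi (fun _ : Fin k => rademacher)) ∂(radPi p k) := by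
  have e := (measurePreserving_piFinSuccAbove
    (fun _ : Fin (p+1) => Measure.pi (fun _ : Fin k => rademacher)) 0).symm
  have h1 := e.integral_comp' f
  have h2 := (e.integrable_comp_emb (MeasurableEquiv.measurableEmbedding _)).2 hf
  refine h1.symm.trans ((integral_prod_symm _ h2).trans ?_)
  simp only [MeasurableEquiv.piFinSuccAbove, Fin.insertNthEquiv_zero]
  rfl

lemma colDot_cons {p k : ℕ} (r : Fin k → ℝ) (W : Fin p → Fin k → ℝ) (u : Fin (p+1) → ℝ)
    (j : Fin k) : colDot (Fin.cons r W : Fin (p+1) → Fin k → ℝ) u j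
      = r j * u 0 + colDot W (fun i => u i.succ) j := by
  simp [colDot, Fin.sum_univ_succ]

lemma cons_ae {p k : ℕ} (W : Fin p → Fin k → ℝ) (u v : Fin (p+1) → ℝ) :
    ∀ᵐ r ∂(Measure.pi (fun _ : Fin k => rademacher)),
      ∑ j, colDot (Fin.cons r W : Fin (p+1) → Fin k → ℝ) u j
        * colDot (Fin.cons r W : Fin (p+1) → Fin k → ℝ) v j
      = (∑ j, colDot W (fun i => u i.succ) j * colDot W (fun i => v i.succ) j + k * (u 0 * v 0))
        + ∑ j, (u 0 * colDot W (fun i => v i.succ) j + v 0 * colDot W (fun i => u i.succ) j)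
          * r j := by
  have h : ∀ᵐ r ∂(Measure.pi (fun _ : Fin k => rademacher)), ∀ j, r j ^ 2 = 1 :=
    ae_all_iff.2 fun j => (measurePreserving_eval (fun _ : Fin k => rademacher)
      j).quasiMeasurePreserving.ae rad_ae
  filter_upwards [h] with r hr
  have : (k : ℝ) * (u 0 * v 0) = ∑ j : Fin k, u 0 * v 0 := by simp
  rw [this, ← Finset.sum_add_distrib, ← Finset.sum_add_distrib]
  refine Finset.sum_congr rfl fun j _ => ?_
  rw [colDot_cons, colDot_cons]
  linear_combination (u 0 * v 0) * hr j

lemma F_memLp {p k : ℕ} (u v : Fin p → ℝ) :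
    MemLp (fun W => ∑ j, colDot W u j * colDot W v j) 2 (radPi p k) :=
  aux_memLp_sum (colDot_memLp u) (colDot_memLp v)

lemma F_int {p k : ℕ} (u v : Fin p → ℝ) :
    Integrable (fun W => ∑ j, colDot W u j * colDot W v j) (radPi p k) :=
  (F_memLp u v).integrable (by norm_num)

lemma F_mean (k : ℕ) : ∀ (p : ℕ) (u v : Fin p → ℝ),
    ∫ W, ∑ j, colDot W u j * colDot W v j ∂(radPi p k) = k * ∑ i, u i * v i
  | 0, u, v => by simp [colDot]
  | p+1, u, v => by
    rw [radPi_succ _ (F_int u v)]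
    simp_rw [fun W => integral_congr_ae (cons_ae (k := k) W u v),
      aux_int_sum rademacher (rad_memLp 2) rad_int]
    rw [integral_add (F_int _ _) (integrable_const _), F_mean k p, Fin.sum_univ_succ]
    simp
    ring

lemma F_sq (k : ℕ) : ∀ (p : ℕ) (u v : Fin p → ℝ),
    ∫ W, (∑ j, colDot W u j * colDot W v j) ^ 2 ∂(radPi p k) = k ^ 2 * (∑ i, u i * v i) ^ 2
      + k * ((∑ i, u i ^ 2) * (∑ i, v i ^ 2) + (∑ i, u i * v i) ^ 2 - 2 * ∑ i, u i ^ 2 * v i ^ 2)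
  | 0, u, v => by simp [colDot]
  | p+1, u, v => by
    rw [radPi_succ _ (F_memLp u v).integrable_sq]
    have h : ∀ W : Fin p → Fin k → ℝ,
        ∫ r, (∑ j, colDot (Fin.cons r W : Fin (p+1) → Fin k → ℝ) u j
        * colDot (Fin.cons r W : Fin (p+1) → Fin k → ℝ) v j) ^ 2
          ∂(Measure.pi (fun _ : Fin k => rademacher))
        = (∑ j, colDot W (fun i => u i.succ) j * colDot W (fun i => v i.succ) j) ^ 2
          + (2 * k + 2) * (u 0 * v 0) *
            (∑ j, colDot W (fun i => u i.succ) j * colDot W (fun i => v i.succ) j)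
          + u 0 ^ 2 * (∑ j, colDot W (fun i => v i.succ) j * colDot W (fun i => v i.succ) j)
          + v 0 ^ 2 * (∑ j, colDot W (fun i => u i.succ) j * colDot W (fun i => u i.succ) j)
          + k ^ 2 * (u 0 * v 0) ^ 2 := by
      intro W
      rw [integral_congr_ae ((cons_ae (k := k) W u v).mono fun r hr => congrArg (· ^ 2) hr),
        aux_int_sq rademacher (rad_memLp 2) rad_int 1 rad_var]
      have : ∑ j, (u 0 * colDot W (fun i => v i.succ) j + v 0 * colDot W (fun i => u i.succ) j) ^ 2
        = 2 * (u 0 * v 0) *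
            (∑ j, colDot W (fun i => u i.succ) j * colDot W (fun i => v i.succ) j)
          + u 0 ^ 2 * (∑ j, colDot W (fun i => v i.succ) j * colDot W (fun i => v i.succ) j)
          + v 0 ^ 2 * (∑ j, colDot W (fun i => u i.succ) j * colDot W (fun i => u i.succ) j) := by
        simp_rw [Finset.mul_sum, ← Finset.sum_add_distrib]
        exact Finset.sum_congr rfl fun j _ => by ring
      rw [this]; ring
    simp_rw [h]
    have i1 := (F_memLp (k := k) (fun i => u i.succ) (fun i => v i.succ)).integrable_sq
    have i2 := (F_int (k := k) (fun i => u i.succ) (fun i => v i.succ)).const_mul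
      ((2 * k + 2) * (u 0 * v 0))
    have i3 := (F_int (k := k) (fun i => v i.succ) (fun i => v i.succ)).const_mul (u 0 ^ 2)
    have i4 := (F_int (k := k) (fun i => u i.succ) (fun i => u i.succ)).const_mul (v 0 ^ 2)
    rw [aux_int4 i1 i2 i3 i4, integral_const_mul, integral_const_mul, integral_const_mul, F_mean, F_mean, F_mean,
      F_sq k p]
    simp only [Fin.sum_univ_succ, ← pow_two]
    ring

lemma noise_mean {k : ℕ} (μ : Measure ℝ) [IsProbabilityMeasure μ] (h4 : MemLp id 4 μ)
    (h0 : ∫ x, x ∂μ = 0) (x y : Fin k → ℝ) (s : ℝ) (hs : Var[id; μ] = s) :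
    (∫ a : Fin k → ℝ, ∫ b : Fin k → ℝ, (∑ j, (x j + a j) * (y j + b j))
      ∂(Measure.pi fun _ => μ) ∂(Measure.pi fun _ => μ) = ∑ j, x j * y j) ∧
    (∫ a : Fin k → ℝ, ∫ b : Fin k → ℝ, (∑ j, (x j + a j) * (y j + b j)) ^ 2
      ∂(Measure.pi fun _ => μ) ∂(Measure.pi fun _ => μ) =
      (∑ j, x j * y j) ^ 2 + s * (∑ j, x j * x j) + s * (∑ j, y j * y j) + k * s ^ 2) := by
  have h2 : MemLp id 2 μ := h4.mono_exponent (by norm_num)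
  have e1 : ∀ a b : Fin k → ℝ, ∑ j, (x j + a j) * (y j + b j)
      = ∑ j, (x j + a j) * y j + ∑ j, (x j + a j) * b j := fun a b => by
    rw [← Finset.sum_add_distrib]; exact Finset.sum_congr rfl fun j _ => by ring
  have e2 : ∀ a : Fin k → ℝ, ∑ j, (x j + a j) * y j
      = ∑ j, x j * y j + ∑ j, y j * a j := fun a => by
    rw [← Finset.sum_add_distrib]; exact Finset.sum_congr rfl fun j _ => by ring
  have hm : ∀ j : Fin k, MemLp (fun a : Fin k → ℝ => a j) 2 (Measure.pi fun _ => μ) := fun j =>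
    h2.comp_measurePreserving (measurePreserving_eval (fun _ : Fin k => μ) j)
  constructor
  · simp_rw [e1, aux_int_sum μ h2 h0, e2, aux_int_sum μ h2 h0]
  · simp_rw [e1, aux_int_sq μ h2 h0 s hs, e2]
    have i1 : Integrable (fun a : Fin k → ℝ => (∑ j, x j * y j + ∑ j, y j * a j) ^ 2)
        (Measure.pi fun _ => μ) := by
      have hq : MemLp (fun a : Fin k → ℝ => ∑ j, y j * a j) 2 (Measure.pi fun _ => μ) :=
        memLp_finsetSum _ fun j _ => (hm j).const_mul (y j)
      have hq' : MemLp (fun a : Fin k → ℝ => ∑ j, x j * y j + ∑ j, y j * a j) 2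
        (Measure.pi fun _ => μ) := (memLp_const (∑ j, x j * y j)).add hq
      exact hq'.integrable_sq
    have i2 : ∀ j : Fin k, Integrable (fun a : Fin k → ℝ => (x j + a j) ^ 2)
        (Measure.pi fun _ => μ) := fun j => by
      have hq : MemLp (fun a : Fin k → ℝ => x j + a j) 2 (Measure.pi fun _ => μ) :=
        (memLp_const (x j)).add (hm j)
      exact hq.integrable_sq
    rw [integral_add i1 ((integrable_finsetSum _ fun j _ => i2 j).const_mul _),
      aux_int_sq μ h2 h0 s hs, integral_const_mul, integral_finsetSum _ fun j _ => i2 j]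
    simp_rw [aux_int_coord μ h2 h0 s hs, Finset.sum_add_distrib, ← pow_two]
    simp
    ring

theorem dp_rp_g_opt_b_inner_product (p k : ℕ) (hp : 0 < p) (hk : 0 < k)
    (σ : ℝ) (hσ : 0 < σ) (u v : Fin p → ℝ) :
    (∫ z : (Fin p → Fin k → ℝ) × ((Fin k → ℝ) × (Fin k → ℝ)),
        (∑ j : Fin k,
          ((1 / Real.sqrt k) * (∑ i : Fin p, z.1 i j * u i) + z.2.1 j)
            * ((1 / Real.sqrt k) * (∑ i : Fin p, z.1 i j * v i) + z.2.2 j))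
        ∂(Measure.prod
            (Measure.pi (fun _ : Fin p => Measure.pi (fun _ : Fin k => rademacher)))
            (Measure.prod
              (Measure.pi (fun _ : Fin k => gaussianReal 0 ⟨σ ^ 2, sq_nonneg σ⟩))
              (Measure.pi (fun _ : Fin k => gaussianReal 0 ⟨σ ^ 2, sq_nonneg σ⟩)))))
      = ∑ i : Fin p, u i * v i
    ∧ variance
        (fun z : (Fin p → Fin k → ℝ) × ((Fin k → ℝ) × (Fin k → ℝ)) =>
          ∑ j : Fin k,
            ((1 / Real.sqrt k) * (∑ i : Fin p, z.1 i j * u i) + z.2.1 j)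
              * ((1 / Real.sqrt k) * (∑ i : Fin p, z.1 i j * v i) + z.2.2 j))
        (Measure.prod
            (Measure.pi (fun _ : Fin p => Measure.pi (fun _ : Fin k => rademacher)))
            (Measure.prod
              (Measure.pi (fun _ : Fin k => gaussianReal 0 ⟨σ ^ 2, sq_nonneg σ⟩))
              (Measure.pi (fun _ : Fin k => gaussianReal 0 ⟨σ ^ 2, sq_nonneg σ⟩))))
      = σ ^ 2 * ∑ i : Fin p, (u i ^ 2 + v i ^ 2) + k * σ ^ 4
          + (1 / k) * ((∑ i : Fin p, u i ^ 2) * (∑ i : Fin p, v i ^ 2)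
              + (∑ i : Fin p, u i * v i) ^ 2 - 2 * ∑ i : Fin p, u i ^ 2 * v i ^ 2) := by

  set μ : Measure ℝ := gaussianReal 0 ⟨σ ^ 2, sq_nonneg σ⟩ with hμ
  have : IsProbabilityMeasure μ := instIsProbabilityMeasureGaussianReal 0 _
  have h4 : MemLp id 4 μ := memLp_id_gaussianReal' 4 (by simp)
  have h0 : ∫ x, x ∂μ = 0 := integral_id_gaussianReal
  have hs : Var[id; μ] = σ ^ 2 := variance_id_gaussianReal
  have hk0 : (k : ℝ) ≠ 0 := by exact_mod_cast hk.ne'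
  have hc : (1 / √(k : ℝ)) * (1 / √(k : ℝ)) = 1 / k := by
    rw [div_mul_div_comm, Real.mul_self_sqrt (by positivity), one_mul]
  set c : ℝ := 1 / √(k : ℝ) with hcdef
  set G : (Fin p → Fin k → ℝ) × ((Fin k → ℝ) × (Fin k → ℝ)) → ℝ := fun z =>
    ∑ j : Fin k, (c * (∑ i : Fin p, z.1 i j * u i) + z.2.1 j)
      * (c * (∑ i : Fin p, z.1 i j * v i) + z.2.2 j) with hG
  set Q := Measure.prod (radPi p k) (Measure.prod (Measure.pi (fun _ : Fin k => μ))
    (Measure.pi (fun _ : Fin k => μ))) with hQ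
  have : IsProbabilityMeasure Q := by rw [hQ]; infer_instance
  change (∫ z, G z ∂Q) = _ ∧ variance G Q = _
  have hm : MemLp G 2 Q := by
    refine aux_memLp_sum (fun j => ?_) (fun j => ?_)
    · refine MemLp.add (MemLp.const_mul ((colDot_memLp u j).comp_measurePreserving
        measurePreserving_fst) c) ?_
      exact ((h4.comp_measurePreserving (measurePreserving_eval (fun _ : Fin k => μ) j)
        ).comp_measurePreserving measurePreserving_fst).comp_measurePreserving
          measurePreserving_snd
    · refine MemLp.add (MemLp.const_mul ((colDot_memLp v j).comp_measurePreserving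
        measurePreserving_fst) c) ?_
      exact ((h4.comp_measurePreserving (measurePreserving_eval (fun _ : Fin k => μ) j)
        ).comp_measurePreserving measurePreserving_snd).comp_measurePreserving
          measurePreserving_snd
  have key : ∀ f : (Fin p → Fin k → ℝ) × ((Fin k → ℝ) × (Fin k → ℝ)) → ℝ, Integrable f Q →
      ∫ z, f z ∂Q = ∫ W, ∫ a, ∫ b, f (W, (a, b)) ∂(Measure.pi (fun _ : Fin k => μ))
        ∂(Measure.pi (fun _ : Fin k => μ)) ∂(radPi p k) := by
    intro f hf
    rw [hQ, integral_prod _ hf]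
    refine integral_congr_ae ?_
    filter_upwards [hf.prod_right_ae] with W hW
    exact integral_prod _ hW
  have hxy : ∀ (W : Fin p → Fin k → ℝ) (s t : Fin p → ℝ),
      ∑ j, (c * colDot W s j) * (c * colDot W t j)
        = (1 / k) * ∑ j, colDot W s j * colDot W t j := fun W s t => by
    rw [← hc, Finset.mul_sum]; exact Finset.sum_congr rfl fun j _ => by ring
  have hmean : ∫ z, G z ∂Q = ∑ i, u i * v i := by
    rw [key G (hm.integrable (by norm_num))]
    have : ∀ W : Fin p → Fin k → ℝ, ∫ a, ∫ b, G (W, (a, b)) ∂(Measure.pi (fun _ : Fin k => μ))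
        ∂(Measure.pi (fun _ : Fin k => μ)) = (1 / k) * ∑ j, colDot W u j * colDot W v j :=
      fun W => by
        rw [← hxy]
        exact (noise_mean μ h4 h0 (fun j => c * colDot W u j) (fun j => c * colDot W v j) _ hs).1
    simp_rw [this]
    rw [integral_const_mul, F_mean]
    field_simp
  refine ⟨hmean, ?_⟩
  rw [variance_eq_sub hm, hmean]
  simp only [Pi.pow_apply]
  rw [key (fun z => G z ^ 2) hm.integrable_sq]
  have : ∀ W : Fin p → Fin k → ℝ, ∫ a, ∫ b, G (W, (a, b)) ^ 2 ∂(Measure.pi (fun _ : Fin k => μ))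
      ∂(Measure.pi (fun _ : Fin k => μ)) = (1 / k) ^ 2 * (∑ j, colDot W u j * colDot W v j) ^ 2
        + σ ^ 2 * (1 / k) * (∑ j, colDot W u j * colDot W u j)
        + σ ^ 2 * (1 / k) * (∑ j, colDot W v j * colDot W v j) + k * (σ ^ 2) ^ 2 :=
    fun W => by
      refine (noise_mean μ h4 h0 (fun j => c * colDot W u j) (fun j => c * colDot W v j)
        _ hs).2.trans ?_
      rw [hxy, hxy, hxy]; ring
  simp_rw [this]
  have i1 := (F_memLp (k := k) u v).integrable_sq.const_mul ((1 / (k : ℝ)) ^ 2)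
  have i2 := (F_int (k := k) u u).const_mul (σ ^ 2 * (1 / k))
  have i3 := (F_int (k := k) v v).const_mul (σ ^ 2 * (1 / k))
  have hI := aux_int4 i1 i2 i3 (integrable_const (μ := radPi p k) (0 : ℝ)) (k * (σ ^ 2) ^ 2)
  simp only [add_zero, integral_zero] at hI
  rw [hI, integral_const_mul, integral_const_mul, integral_const_mul, F_mean, F_mean, F_sq]
  simp only [← pow_two, Finset.sum_add_distrib]
  field_simp
  ring
end

section
/- Let p, k be positive integers with k dividing p, set m = p/k, fix ε > 0, β > 0, a permutation π of {1,…,p}, and a sign vector w ∈ {−1,1}^p. For u ∈ [−1,1]^p define its OPORP sketch x ∈ ℝ^k by x_j = Σ_{l=(j−1)m+1}^{jm} w_l · u_{π^{−1}(l)}. Define the randomized output s̃ ∈ {−1,1}^k by, independently for each j: if x_j ≠ 0, set L_j = ⌈|x_j|/β⌉ and output s̃_j = sign(x_j) with probability e^{L_j·ε}/(e^{L_j·ε}+1) and s̃_j = −sign(x_j) otherwise; if x_j = 0, output s̃_j uniformly at random in {−1,1}. Then for any two β-adjacent vectors u, u′ ∈ [−1,1]^p, letting s̃ and s̃′ denote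 the respective randomized outputs (with the same π and w), for every y ∈ {−1,1}^k it holds that Pr(s̃ = y) ≤ e^ε · Pr(s̃′ = y). -/
open MeasureTheory ProbabilityTheory Real

/-- The sign function: `+1` for `t ≥ 0` and `−1` for `t < 0`. -/
noncomputable def psign (t : ℝ) : ℝ := if 0 ≤ t then 1 else -1

/-- The uniform distribution on `[0,1]`, used to drive the random sign flips. -/
noncomputable def uniform01 : Measure ℝ := volume.restrict (Set.Icc (0 : ℝ) 1)

instance : IsProbabilityMeasure uniform01 :=
  ⟨by rw [uniform01, Measure.restrict_apply_univ, Real.volume_Icc]; norm_num⟩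

/-- The OPORP sketch of `u ∈ ℝᵖ` with permutation `e`, sign vector `w`, and `k`
consecutive bins of length `m = p/k`: the `j`-th output is
`Σ_{l : ⌊l/m⌋ = j} w_l · u_{e⁻¹(l)}`. -/
noncomputable def oporp (p k : ℕ) (e : Equiv.Perm (Fin p)) (w : Fin p → ℝ)
    (u : Fin p → ℝ) (j : Fin k) : ℝ :=
  ∑ l ∈ Finset.univ.filter (fun l : Fin p => (l : ℕ) / (p / k) = (j : ℕ)),
    w l * u (e.symm l)

/-- The DP-SignOPORP-RR-smooth output: for each bin `j`, if `x_j ≠ 0`, keep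
`sign(x_j)` with the smooth flipping probability `e^{L_j ε}/(e^{L_j ε}+1)` where
`L_j = ⌈|x_j|/β⌉`, and flip it otherwise; if `x_j = 0`, output a uniformly random
sign. All randomness is driven by the uniform variables `r j`. -/
noncomputable def signOporpSmooth (p k : ℕ) (β ε : ℝ) (e : Equiv.Perm (Fin p))
    (w : Fin p → ℝ) (u : Fin p → ℝ) (r : Fin k → ℝ) (j : Fin k) : ℝ :=
  if oporp p k e w u j ≠ 0 then
    (if r j ≤ Real.exp ((⌈|oporp p k e w u j| / β⌉ : ℝ) * ε)
          / (Real.exp ((⌈|oporp p k e w u j| / β⌉ : ℝ) * ε) + 1)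
      then psign (oporp p k e w u j)
      else -psign (oporp p k e w u j))
  else (if r j ≤ 1 / 2 then 1 else -1)

noncomputable def thr (β ε x : ℝ) : ℝ :=
  Real.exp ((⌈|x| / β⌉ : ℝ) * ε) / (Real.exp ((⌈|x| / β⌉ : ℝ) * ε) + 1)

noncomputable def outp (β ε x t : ℝ) : ℝ :=
  if t ≤ thr β ε x then psign x else -psign x

lemma smooth_eq_outp (p k : ℕ) (β ε : ℝ) (e : Equiv.Perm (Fin p))
    (w : Fin p → ℝ) (u : Fin p → ℝ) (r : Fin k → ℝ) (j : Fin k) :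
    signOporpSmooth p k β ε e w u r j = outp β ε (oporp p k e w u j) (r j) := by
  unfold signOporpSmooth outp thr
  by_cases h : oporp p k e w u j = 0
  · simp only [h, psign]
    norm_num
  · simp [h]

lemma unif_le (c : ℝ) (h0 : 0 ≤ c) (h1 : c ≤ 1) :
    uniform01 {t : ℝ | t ≤ c} = ENNReal.ofReal c := by
  rw [uniform01, Measure.restrict_apply' measurableSet_Icc]
  have : {t : ℝ | t ≤ c} ∩ Set.Icc 0 1 = Set.Icc 0 c := by
    ext t
    simp only [Set.mem_inter_iff, Set.mem_ofPred_eq, Set.mem_Icc]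
    constructor
    · rintro ⟨a, b, d⟩
      exact ⟨b, a⟩
    · rintro ⟨a, b⟩
      exact ⟨b, a, b.trans h1⟩
  rw [this, Real.volume_Icc, sub_zero]

lemma unif_gt (c : ℝ) (h0 : 0 ≤ c) (h1 : c ≤ 1) :
    uniform01 {t : ℝ | c < t} = ENNReal.ofReal (1 - c) := by
  rw [uniform01, Measure.restrict_apply' measurableSet_Icc]
  have : {t : ℝ | c < t} ∩ Set.Icc 0 1 = Set.Ioc c 1 := by
    ext t
    simp only [Set.mem_inter_iff, Set.mem_ofPred_eq, Set.mem_Icc, Set.mem_Ioc]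
    constructor
    · rintro ⟨a, b, d⟩
      exact ⟨a, d⟩
    · rintro ⟨a, b⟩
      exact ⟨a, h0.trans a.le, b⟩
  rw [this, Real.volume_Ioc]

lemma psign_cases (x : ℝ) : (0 ≤ x ∧ psign x = 1) ∨ (x < 0 ∧ psign x = -1) := by
  unfold psign
  rcases le_or_gt 0 x with h | h
  · left; simp [h]
  · right; simp [h]

lemma prob_outp (β ε x s : ℝ) (hs : s = 1 ∨ s = -1) :
    uniform01 {t : ℝ | outp β ε x t = s}
      = ENNReal.ofReal (if s = psign x then thr β ε x else 1 - thr β ε x) := by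
  have hE := Real.exp_pos ((⌈|x| / β⌉ : ℝ) * ε)
  have h0 : 0 ≤ thr β ε x := by unfold thr; positivity
  have h1 : thr β ε x ≤ 1 := by
    unfold thr; rw [div_le_one (by positivity)]; linarith
  split_ifs with h
  · rw [← unif_le _ h0 h1]
    congr 1
    ext t
    simp only [Set.mem_ofPred_eq, outp]
    rcases psign_cases x with ⟨_, hx⟩ | ⟨_, hx⟩ <;> rw [hx] at h ⊢ <;> subst h <;>
      split_ifs <;> norm_num <;> linarith
  · rw [← unif_gt _ h0 h1]
    congr 1
    ext t
    simp only [Set.mem_ofPred_eq, outp]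
    rcases psign_cases x with ⟨_, hx⟩ | ⟨_, hx⟩ <;> rw [hx] at h ⊢ <;>
      rcases hs with hs | hs <;> subst hs <;>
      first
      | exact absurd rfl h
      | (split_ifs <;> norm_num <;> linarith)

lemma ceil_step (β x x' : ℝ) (hβ : 0 < β) (h : |x - x'| ≤ β) :
    (⌈|x| / β⌉ : ℝ) ≤ ⌈|x'| / β⌉ + 1 := by
  have : ⌈|x| / β⌉ ≤ ⌈|x'| / β⌉ + 1 := by
    rw [Int.ceil_le]
    push_cast
    have h2 := Int.le_ceil (|x'| / β)
    have h3 : |x| / β ≤ |x'| / β + 1 := by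
      rw [div_add_one hβ.ne']
      gcongr
      have := abs_sub_abs_le_abs_sub x x'
      linarith
    linarith
  exact_mod_cast this

lemma ceil_le_one' (β x : ℝ) (hβ : 0 < β) (h : |x| ≤ β) : (⌈|x| / β⌉ : ℝ) ≤ 1 := by
  have : ⌈|x| / β⌉ ≤ 1 := by
    rw [Int.ceil_le]
    push_cast
    rwa [div_le_one hβ]
  exact_mod_cast this

lemma real_key (β ε x x' s : ℝ) (hβ : 0 < β) (hε : 0 < ε) (h : |x - x'| ≤ β)
    (hs : s = 1 ∨ s = -1) :
    (if s = psign x then thr β ε x else 1 - thr β ε x) ≤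
      Real.exp ε * (if s = psign x' then thr β ε x' else 1 - thr β ε x') := by
  have a1 := ceil_step β x x' hβ h
  have a2 := ceil_step β x' x hβ (by rwa [abs_sub_comm])
  have n1 : (0:ℝ) ≤ ⌈|x| / β⌉ := by exact_mod_cast Int.ceil_nonneg (by positivity)
  have n2 : (0:ℝ) ≤ ⌈|x'| / β⌉ := by exact_mod_cast Int.ceil_nonneg (by positivity)
  have b1 := ceil_le_one' β x hβ
  have b2 := ceil_le_one' β x' hβ
  unfold thr
  generalize (⌈|x| / β⌉ : ℝ) = n at *
  generalize (⌈|x'| / β⌉ : ℝ) = n' at *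
  have e1 : Real.exp (n * ε) ≤ Real.exp ε * Real.exp (n' * ε) := by
    rw [← Real.exp_add]; apply Real.exp_le_exp.2; nlinarith
  have e2 : Real.exp (n' * ε) ≤ Real.exp ε * Real.exp (n * ε) := by
    rw [← Real.exp_add]; apply Real.exp_le_exp.2; nlinarith
  have f1 : 1 ≤ Real.exp (n * ε) := Real.one_le_exp (by positivity)
  have f2 : 1 ≤ Real.exp (n' * ε) := Real.one_le_exp (by positivity)
  have f3 : 1 ≤ Real.exp ε := Real.one_le_exp hε.le
  have g1 : |x| ≤ β → Real.exp (n * ε) ≤ Real.exp ε := fun hx => by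
    apply Real.exp_le_exp.2; have := b1 hx; nlinarith
  have g2 : |x'| ≤ β → Real.exp (n' * ε) ≤ Real.exp ε := fun hx => by
    apply Real.exp_le_exp.2; have := b2 hx; nlinarith
  generalize Real.exp (n * ε) = E at *
  generalize Real.exp (n' * ε) = F at *
  generalize Real.exp ε = c at *
  have r1 : 1 - E / (E + 1) = 1 / (E + 1) := by field_simp; ring
  have r2 : 1 - F / (F + 1) = 1 / (F + 1) := by field_simp; ring
  have pE : 0 < E + 1 := by linarith
  have pF : 0 < F + 1 := by linarith
  have q0 : 0 ≤ (c - 1) * (E * F) := mul_nonneg (by linarith) (by nlinarith)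
  have k1 : E / (E + 1) ≤ c * (F / (F + 1)) := by
    rw [← mul_div_assoc, div_le_div_iff₀ pE pF]; nlinarith
  have k2 : 1 / (E + 1) ≤ c * (1 / (F + 1)) := by
    rw [← mul_div_assoc, div_le_div_iff₀ pE pF]; nlinarith
  have k4 : 1 / (E + 1) ≤ c * (F / (F + 1)) := by
    refine le_trans ?_ k1
    gcongr
  rw [r1, r2]
  have hh := abs_le.1 h
  rcases psign_cases x with ⟨hx, sx⟩ | ⟨hx, sx⟩ <;>
    rcases psign_cases x' with ⟨hx', sx'⟩ | ⟨hx', sx'⟩ <;> rw [sx, sx']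
  · split_ifs <;> assumption
  · have hF := g2 (abs_le.2 ⟨by linarith, by linarith⟩)
    have hE := g1 (abs_le.2 ⟨by linarith, by linarith⟩)
    have k3' : E / (E + 1) ≤ c * (1 / (F + 1)) := by
      rw [← mul_div_assoc, div_le_div_iff₀ pE pF]
      nlinarith [mul_nonneg (sub_nonneg.2 hF) (by linarith : (0:ℝ) ≤ E)]
    split_ifs <;> assumption
  · have hF := g2 (abs_le.2 ⟨by linarith, by linarith⟩)
    have hE := g1 (abs_le.2 ⟨by linarith, by linarith⟩)
    have k3' : E / (E + 1) ≤ c * (1 / (F + 1)) := by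
      rw [← mul_div_assoc, div_le_div_iff₀ pE pF]
      nlinarith [mul_nonneg (sub_nonneg.2 hF) (by linarith : (0:ℝ) ≤ E)]
    split_ifs <;> assumption
  · split_ifs <;> assumption

lemma oporp_diff (p k : ℕ) (e : Equiv.Perm (Fin p)) (w u u' : Fin p → ℝ) (i₀ : Fin p)
    (h : ∀ i : Fin p, i ≠ i₀ → u i = u' i) (j : Fin k) :
    oporp p k e w u j - oporp p k e w u' j =
      if ((e i₀ : Fin p) : ℕ) / (p / k) = (j : ℕ) then w (e i₀) * (u i₀ - u' i₀) else 0 := by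
  unfold oporp
  rw [← Finset.sum_sub_distrib, Finset.sum_filter, Finset.sum_eq_single (e i₀)]
  · simp [mul_sub]
  · intro l _ hl
    have : e.symm l ≠ i₀ := fun hc => hl (by rw [← hc]; simp)
    rw [h _ this]
    simp
  · simp

lemma pi_prob (p k : ℕ) (β ε : ℝ) (e : Equiv.Perm (Fin p)) (w u : Fin p → ℝ)
    (y : Fin k → ℝ) :
    (Measure.pi (fun _ : Fin k => uniform01))
        {r : Fin k → ℝ | ∀ j, signOporpSmooth p k β ε e w u r j = y j}
      = ∏ j, uniform01 {t : ℝ | outp β ε (oporp p k e w u j) t = y j} := by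
  rw [← Measure.pi_pi]
  congr 1
  ext r
  simp [smooth_eq_outp]

/-- **DP-SignOPORP-RR-smooth is `ε`-DP.** For fixed `π` (here `e`) and
`w ∈ {−1,1}ᵖ`, any `β`-adjacent `u, u' ∈ [−1,1]ᵖ`, and every `y ∈ {−1,1}ᵏ`,
`Pr(s̃ = y) ≤ e^ε · Pr(s̃' = y)`, the probabilities being over the independent
per-coordinate randomness. -/
theorem dp_sign_oporp_rr_smooth (p k : ℕ) (hp : 0 < p) (hk : 0 < k) (hkp : k ∣ p)
    (β ε : ℝ) (hβ : 0 < β) (hε : 0 < ε)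
    (e : Equiv.Perm (Fin p)) (w : Fin p → ℝ) (hw : ∀ l, w l = 1 ∨ w l = -1)
    (u u' : Fin p → ℝ)
    (hu : ∀ i, u i ∈ Set.Icc (-1 : ℝ) 1) (hu' : ∀ i, u' i ∈ Set.Icc (-1 : ℝ) 1)
    (hadj : Adjacent β u u')
    (y : Fin k → ℝ) (hy : ∀ j, y j = 1 ∨ y j = -1) :
    (Measure.pi (fun _ : Fin k => uniform01))
        {r : Fin k → ℝ | ∀ j, signOporpSmooth p k β ε e w u r j = y j}
      ≤ ENNReal.ofReal (Real.exp ε)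
          * (Measure.pi (fun _ : Fin k => uniform01))
              {r : Fin k → ℝ | ∀ j, signOporpSmooth p k β ε e w u' r j = y j} := by
  obtain ⟨i₀, _, hle, hi⟩ := hadj
  have hd := oporp_diff p k e w u u' i₀ hi
  rw [pi_prob, pi_prob]
  have hlt : ((e i₀ : Fin p) : ℕ) / (p / k) < k := by
    rw [Nat.div_lt_iff_lt_mul (Nat.div_pos (Nat.le_of_dvd hp hkp) hk),
      Nat.mul_div_cancel' hkp]
    exact (e i₀).isLt
  let j₀ : Fin k := ⟨_, hlt⟩
  rw [← Finset.mul_prod_erase Finset.univ _ (Finset.mem_univ j₀),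
    ← Finset.mul_prod_erase Finset.univ
      (fun j => uniform01 {t : ℝ | outp β ε (oporp p k e w u' j) t = y j}) (Finset.mem_univ j₀),
    ← mul_assoc]
  refine mul_le_mul' ?_ (le_of_eq ?_)
  · rw [prob_outp _ _ _ _ (hy j₀), prob_outp _ _ _ _ (hy j₀),
      ← ENNReal.ofReal_mul (Real.exp_pos ε).le]
    apply ENNReal.ofReal_le_ofReal
    apply real_key _ _ _ _ _ hβ hε _ (hy j₀)
    rw [hd j₀, if_pos rfl, abs_mul]
    have : |w (e i₀)| = 1 := by
      rcases hw (e i₀) with h | h <;> rw [h] <;> norm_num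
    rwa [this, one_mul]
  · apply Finset.prod_congr rfl
    intro j hj
    have hne : j ≠ j₀ := (Finset.mem_erase.1 hj).1
    have := hd j
    rw [if_neg (fun hc => hne (Fin.ext hc.symm))] at this
    rw [sub_eq_zero.1 this]
end
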